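/- Let p be an odd prime, q = p^m with q = 2^a·b + 1, b odd, a ≥ 2, let r ≥ 2, and N = 2^r·p^s. Let C be the ideal of R = F_q[x]/(x^N − 1) generated by m_0(x)^{j_0} · m_{2^{r−1}}(x)^{j_{2^{r−1}}} · ∏_{i=2}^r ∏_{s ∈ D_i} m_{2^{r−i}s}(x)^{j_{2^{r−i}s}}, where 0 ≤ j_t ≤ p^s for each t ∈ T_n. Then Hull(C) = C ∩ C^⊥ is the ideal of R generated by m_0(x)^{max(j_0, p^s−j_0)} · m_{2^{r−1}}(x)^{max(j_{2^{r−1}}, p^s−j_{2^{r−1}})} · ∏_{i=2}^r ∏_{s ∈ D_i} m_{2^{r−i}s}(x)^{max(j_{2^{r−i}s}, p^s−j_{2^{r−i}(−s)})}, and its F_q-dimension equals 2^r·p^s − (max(j_0, p^s−j_0) + max(j_{2^{r−1}}, p^s−j_{2^{r−1}}) + e), where e = Σ_{i=2}^r Σ_{s ∈ D_i} max(j_{2^{r−i}s}, p^s−j_{2^{r−i}(−s)}) if r ≤ a, and e = Σ_{i=2}^a Σ_{s ∈ D_i} max(j_{2^{r−i}s}, p^s−j_{2^{r−i}(−s)})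 + Σ_{i=a+1}^r Σ_{s ∈ D_i} 2^{i−a}·max(j_{2^{r−i}s}, p^s−j_{2^{r−i}(−s)}) if r > a. -/

import Mathlib

open Polynomial

/-- The coefficient vector (with respect to the basis `1, x, …, x^{deg f − 1}` of
`F[x]/(f)`) of an element of `F[x]/(f)`. -/
noncomputable def coeffRepr {F : Type*} [Field F] {f : Polynomial F} (hf : f ≠ 0)
    (x : AdjoinRoot f) (i : Fin (AdjoinRoot.powerBasis hf).dim) : F :=
  (AdjoinRoot.powerBasis hf).basis.repr x i

/-- The (Euclidean) dual code of a cyclic code `C ⊆ F[x]/(f)`. -/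
noncomputable def dualCode {F : Type*} [Field F] {f : Polynomial F} (hf : f ≠ 0)
    (C : Ideal (AdjoinRoot f)) : Set (AdjoinRoot f) :=
  {x | ∀ y ∈ C, ∑ i, coeffRepr hf x i * coeffRepr hf y i = 0}

/-- The set `D_i` (for `q = 2^a·b + 1`). -/
def Dfin (a i : ℕ) : Finset ℤ :=
  if i ≤ a then
    ((Finset.range (2 ^ (i - 2))).image fun v => (3 : ℤ) ^ v) ∪
      ((Finset.range (2 ^ (i - 2))).image fun v => -(3 : ℤ) ^ v)
  else
    ((Finset.range (2 ^ (a - 2))).image fun v => (3 : ℤ) ^ v) ∪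
      ((Finset.range (2 ^ (a - 2))).image fun v => -(3 : ℤ) ^ v)

section CyclicCode

variable {F : Type*} [Field F] {N : ℕ}

lemma root_pow_length :
    AdjoinRoot.root (X ^ N - 1 : F[X]) ^ N = 1 := by
  have h : AdjoinRoot.mk (X ^ N - 1 : F[X]) (X ^ N - 1) = 0 := AdjoinRoot.mk_self
  rwa [map_sub, map_pow, map_one, AdjoinRoot.mk_X, sub_eq_zero] at h

/-- The algebra endomorphism of `F[x]/(x^N - 1)` sending `x` to `x⁻¹ = x^(N-1)`. -/
noncomputable def rootInv (F : Type*) [Field F] (N : ℕ) :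
    AdjoinRoot (X ^ N - 1 : F[X]) →ₐ[F] AdjoinRoot (X ^ N - 1 : F[X]) :=
  AdjoinRoot.liftAlgHom _ (Algebra.ofId F _) (AdjoinRoot.root (X ^ N - 1 : F[X]) ^ (N - 1)) (by
    rw [eval₂_sub, eval₂_X_pow, eval₂_one, ← pow_mul, mul_comm, pow_mul, root_pow_length,
      one_pow, sub_self])

lemma rootInv_mk (P : F[X]) :
    rootInv F N (AdjoinRoot.mk _ P) = AdjoinRoot.mk _ (P.comp (X ^ (N - 1))) := by
  have h : rootInv F N (AdjoinRoot.mk _ P) =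
      aeval (AdjoinRoot.root (X ^ N - 1 : F[X]) ^ (N - 1)) P := rfl
  rw [h, ← AdjoinRoot.aeval_eq, aeval_comp]
  simp

lemma rootInv_root :
    rootInv F N (AdjoinRoot.root _) = AdjoinRoot.root _ ^ (N - 1) := by
  rw [← AdjoinRoot.mk_X, rootInv_mk]
  simp

lemma rootInv_rootInv (hN : 0 < N) (x : AdjoinRoot (X ^ N - 1 : F[X])) :
    rootInv F N (rootInv F N x) = x := by
  have h : (rootInv F N).comp (rootInv F N) = AlgHom.id F _ := by
    apply AdjoinRoot.algHom_ext
    obtain ⟨n, rfl⟩ : ∃ n, N = n + 1 := ⟨N - 1, by omega⟩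
    have h1 := root_pow_length (F := F) (N := n + 1)
    simp only [AlgHom.comp_apply, rootInv_root, map_pow, AlgHom.id_apply]
    calc ((AdjoinRoot.root (X ^ (n + 1) - 1 : F[X])) ^ n) ^ n
        = (AdjoinRoot.root (X ^ (n + 1) - 1 : F[X]) ^ n) ^ n *
          AdjoinRoot.root (X ^ (n + 1) - 1 : F[X]) ^ (n + 1) := by rw [h1, mul_one]
      _ = (AdjoinRoot.root (X ^ (n + 1) - 1 : F[X]) ^ (n + 1)) ^ n *
          AdjoinRoot.root (X ^ (n + 1) - 1 : F[X]) := by ring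
      _ = _ := by rw [h1]; simp
  exact DFunLike.congr_fun h x

/-- The Euclidean inner product of coefficient vectors. -/
noncomputable def codeForm (hf : (X ^ N - 1 : F[X]) ≠ 0) :
    LinearMap.BilinForm F (AdjoinRoot (X ^ N - 1 : F[X])) :=
  LinearMap.mk₂ F (fun x y => ∑ i, coeffRepr hf x i * coeffRepr hf y i)
    (fun x y z => by simp [coeffRepr, add_mul, Finset.sum_add_distrib])
    (fun c x y => by simp [coeffRepr, Finset.mul_sum, mul_assoc])
    (fun x y z => by simp [coeffRepr, mul_add, Finset.sum_add_distrib])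
    (fun c x y => by simp [coeffRepr, Finset.mul_sum, mul_left_comm])

lemma codeForm_apply (hf : (X ^ N - 1 : F[X]) ≠ 0) (x y) :
    codeForm hf x y = ∑ i, coeffRepr hf x i * coeffRepr hf y i := rfl

lemma codeForm_root_pow (hN : 0 < N) (hf : (X ^ N - 1 : F[X]) ≠ 0) (k l : ℕ) :
    codeForm hf (AdjoinRoot.root _ ^ k) (AdjoinRoot.root _ ^ l) =
      if k % N = l % N then 1 else 0 := by
  have hdim : (AdjoinRoot.powerBasis hf).dim = N := by
    rw [AdjoinRoot.powerBasis_dim, ← C_1, natDegree_X_pow_sub_C]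
  have hpow (k : ℕ) : (AdjoinRoot.root (X ^ N - 1 : F[X])) ^ k =
      (AdjoinRoot.powerBasis hf).basis ⟨k % N, hdim.symm ▸ Nat.mod_lt _ hN⟩ := by
    rw [PowerBasis.basis_eq_pow, AdjoinRoot.powerBasis_gen]
    conv_lhs => rw [← Nat.div_add_mod k N, pow_add, pow_mul, root_pow_length, one_pow, one_mul]
  rw [codeForm_apply, hpow k, hpow l]
  simp only [coeffRepr, Module.Basis.repr_self, Finsupp.single_apply, mul_ite, mul_one, mul_zero,
    Finset.sum_ite_eq, Finset.mem_univ, if_true, Fin.mk.injEq]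

lemma codeForm_mul_root (hN : 0 < N) (hf : (X ^ N - 1 : F[X]) ≠ 0) (x y) :
    codeForm hf (x * AdjoinRoot.root _) (y * AdjoinRoot.root _) = codeForm hf x y := by
  let μ := LinearMap.mulRight F (AdjoinRoot.root (X ^ N - 1 : F[X]))
  have h : (codeForm hf).compl₁₂ μ μ = codeForm hf := by
    refine LinearMap.BilinForm.ext_basis (AdjoinRoot.powerBasis hf).basis fun i j => ?_
    simp only [LinearMap.compl₁₂_apply, μ, LinearMap.mulRight_apply, PowerBasis.basis_eq_pow,
      AdjoinRoot.powerBasis_gen, ← pow_succ, codeForm_root_pow hN]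
    congr 1
    exact propext (Nat.ModEq.add_iff_right (Nat.ModEq.refl 1))
  exact LinearMap.congr_fun₂ h x y

lemma codeForm_mul (hN : 0 < N) (hf : (X ^ N - 1 : F[X]) ≠ 0) (x y g) :
    codeForm hf x (y * g) = codeForm hf (x * rootInv F N g) y := by
  have hroot (x y) : codeForm hf x (y * AdjoinRoot.root _) =
      codeForm hf (x * rootInv F N (AdjoinRoot.root _)) y := by
    rw [← codeForm_mul_root hN hf (x * _) y, rootInv_root, mul_assoc, ← pow_succ,
      Nat.sub_add_cancel hN, root_pow_length, mul_one]
  obtain ⟨P, rfl⟩ := AdjoinRoot.mk_surjective g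
  induction P using Polynomial.induction_on generalizing x y with
  | C a =>
    rw [AdjoinRoot.mk_C, ← AdjoinRoot.algebraMap_eq, AlgHom.commutes, mul_comm, mul_comm x,
      ← Algebra.smul_def, ← Algebra.smul_def]
    simp
  | add P Q hP hQ => simp only [map_add, mul_add, hP, hQ, LinearMap.add_apply]
  | monomial n a h =>
    rw [pow_succ, ← mul_assoc, (AdjoinRoot.mk _).map_mul, AdjoinRoot.mk_X, ← mul_assoc, hroot, h,
      map_mul (rootInv F N), mul_assoc, mul_comm (rootInv F N _)]

lemma eq_zero_of_codeForm_eq_zero (hf : (X ^ N - 1 : F[X]) ≠ 0) {x}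
    (h : ∀ y, codeForm hf x y = 0) : x = 0 := by
  apply (AdjoinRoot.powerBasis hf).basis.repr.injective
  ext i
  have hi := h ((AdjoinRoot.powerBasis hf).basis i)
  simp only [codeForm_apply, coeffRepr, Module.Basis.repr_self, Finsupp.single_apply] at hi
  simpa using hi

lemma mem_dualCode_span_singleton (hN : 0 < N) (hf : (X ^ N - 1 : F[X]) ≠ 0) {x g} :
    x ∈ dualCode hf (Ideal.span {g}) ↔ x * rootInv F N g = 0 := by
  change (∀ y ∈ Ideal.span {g}, codeForm hf x y = 0) ↔ _
  constructor
  · intro h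
    refine eq_zero_of_codeForm_eq_zero hf fun y => ?_
    rw [← codeForm_mul hN]
    exact h _ (Ideal.mem_span_singleton'.2 ⟨y, rfl⟩)
  · rintro h _ hy
    obtain ⟨y, rfl⟩ := Ideal.mem_span_singleton'.1 hy
    rw [codeForm_mul hN, h, map_zero, LinearMap.zero_apply]

lemma finrank_span_mk {f g : F[X]} (hf : f ≠ 0) (hg : g ∣ f) :
    Module.finrank F (Submodule.restrictScalars F
      (Ideal.span {AdjoinRoot.mk f g} : Ideal (AdjoinRoot f))) =
      f.natDegree - g.natDegree := by
  have : Module.Finite F (AdjoinRoot f) := (AdjoinRoot.powerBasis hf).finite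
  have h1 := Submodule.finrank_quotient_add_finrank
    (Submodule.restrictScalars F (Ideal.span {AdjoinRoot.mk f g} : Ideal (AdjoinRoot f)))
  have h2 : Module.finrank F (AdjoinRoot f) = f.natDegree :=
    finrank_quotient_span_eq_natDegree
  have h3 : Module.finrank F (AdjoinRoot f ⧸ Submodule.restrictScalars F
      (Ideal.span {AdjoinRoot.mk f g} : Ideal (AdjoinRoot f))) = g.natDegree := by
    have hle : Ideal.span {f} ≤ Ideal.span {g} := Ideal.span_singleton_le_span_singleton.2 hg
    have hmap : (Ideal.span {AdjoinRoot.mk f g} : Ideal (AdjoinRoot f)) =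
        (Ideal.span {g}).map (Ideal.Quotient.mkₐ F (Ideal.span {f})) := by
      rw [Ideal.map_span, Set.image_singleton]
      rfl
    rw [hmap, ← finrank_quotient_span_eq_natDegree (f := g)]
    exact ((Submodule.Quotient.restrictScalarsEquiv F _).trans
      (DoubleQuot.quotQuotEquivQuotOfLEₐ F hle).toLinearEquiv).finrank_eq
  omega

end CyclicCode

section Hull

variable {F : Type*} [Field F] {N : ℕ}

lemma mk_mem_span_mk {f g P : F[X]} (hg : g ∣ f) :
    AdjoinRoot.mk f P ∈ (Ideal.span {AdjoinRoot.mk f g} : Ideal (AdjoinRoot f)) ↔ g ∣ P := by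
  rw [Ideal.mem_span_singleton]
  constructor
  · rintro ⟨y, hy⟩
    obtain ⟨Q, rfl⟩ := AdjoinRoot.mk_surjective y
    rw [← map_mul, AdjoinRoot.mk_eq_mk] at hy
    exact (dvd_sub_left (dvd_mul_right g Q)).1 (hg.trans hy)
  · exact map_dvd _

lemma mul_eq_zero_iff_of_dvd_dvd {R : Type*} [CommRing R] {x u v : R} (huv : u ∣ v)
    (hvu : v ∣ u) : x * u = 0 ↔ x * v = 0 := by
  constructor
  · obtain ⟨c, rfl⟩ := huv
    intro h
    rw [← mul_assoc, h, zero_mul]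
  · obtain ⟨c, rfl⟩ := hvu
    intro h
    rw [← mul_assoc, h, zero_mul]

/-- If `x^N - 1 = ∏ M t ^ n` with pairwise coprime factors permuted by `σ` under `x ↦ x⁻¹`, then
the hull of the cyclic code generated by `∏ M t ^ e t` is generated by the product with exponents
`max (e t) (n - e (σ t))`. -/
lemma inter_dualCode_eq {ι : Type*} (T : Finset ι) (M : ι → F[X]) (σ : ι → ι) (e : ι → ℕ) (n : ℕ)
    (hN : 0 < N) (hf : (X ^ N - 1 : F[X]) ≠ 0) (hprod : ∏ t ∈ T, M t ^ n = X ^ N - 1)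
    (hcop : (T : Set ι).Pairwise (Function.onFun IsCoprime M))
    (hσ : ∀ t ∈ T, σ t ∈ T) (hσσ : ∀ t ∈ T, σ (σ t) = t)
    (hinv : ∀ t ∈ T, M (σ t) ∣ (M t).comp (X ^ (N - 1))) (he : ∀ t ∈ T, e t ≤ n) :
    (Ideal.span {AdjoinRoot.mk (X ^ N - 1 : F[X]) (∏ t ∈ T, M t ^ e t)} :
        Set (AdjoinRoot (X ^ N - 1 : F[X]))) ∩
      dualCode hf (Ideal.span {AdjoinRoot.mk (X ^ N - 1 : F[X]) (∏ t ∈ T, M t ^ e t)}) =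
    (Ideal.span {AdjoinRoot.mk (X ^ N - 1 : F[X]) (∏ t ∈ T, M t ^ max (e t) (n - e (σ t)))} :
        Set (AdjoinRoot (X ^ N - 1 : F[X]))) := by
  have hdvd (k : ι → ℕ) (hk : ∀ t ∈ T, k t ≤ n) : ∏ t ∈ T, M t ^ k t ∣ X ^ N - 1 := by
    rw [← hprod]
    exact Finset.prod_dvd_prod_of_dvd _ _ fun t ht => pow_dvd_pow _ (hk t ht)
  have hinv₁ (t) (ht : t ∈ T) : AdjoinRoot.mk (X ^ N - 1 : F[X]) (M (σ t)) ∣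
      rootInv F N (AdjoinRoot.mk _ (M t)) := by
    rw [rootInv_mk]
    exact map_dvd _ (hinv t ht)
  have hinv₂ (t) (ht : t ∈ T) : rootInv F N (AdjoinRoot.mk _ (M t)) ∣
      AdjoinRoot.mk (X ^ N - 1 : F[X]) (M (σ t)) := by
    have h := map_dvd (rootInv F N) (hinv₁ (σ t) (hσ t ht))
    rwa [hσσ t ht, rootInv_rootInv hN] at h
  have hperm : ∏ t ∈ T, M (σ t) ^ e t = ∏ t ∈ T, M t ^ e (σ t) := by
    refine Finset.prod_bij' (fun t _ => σ t) (fun t _ => σ t) hσ hσ hσσ hσσ fun t ht => ?_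
    rw [hσσ t ht]
  have hsplit : (∏ t ∈ T, M t ^ (n - e (σ t))) * ∏ t ∈ T, M t ^ e (σ t) = X ^ N - 1 := by
    rw [← hprod, ← Finset.prod_mul_distrib]
    refine Finset.prod_congr rfl fun t ht => ?_
    rw [← pow_add, Nat.sub_add_cancel (he _ (hσ t ht))]
  ext x
  obtain ⟨P, rfl⟩ := AdjoinRoot.mk_surjective x
  have hdual : AdjoinRoot.mk (X ^ N - 1 : F[X]) P ∈
      dualCode hf (Ideal.span {AdjoinRoot.mk (X ^ N - 1 : F[X]) (∏ t ∈ T, M t ^ e t)}) ↔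
      ∏ t ∈ T, M t ^ (n - e (σ t)) ∣ P := by
    have hne : ∏ t ∈ T, M t ^ e (σ t) ≠ 0 := right_ne_zero_of_mul (hsplit.trans_ne hf)
    rw [mem_dualCode_span_singleton hN, ← mul_dvd_mul_iff_right hne, hsplit,
      ← AdjoinRoot.mk_eq_zero, map_mul, ← hperm]
    apply mul_eq_zero_iff_of_dvd_dvd
    · simp only [map_prod, map_pow]
      exact Finset.prod_dvd_prod_of_dvd _ _ fun t ht => pow_dvd_pow_of_dvd (hinv₂ t ht) _
    · simp only [map_prod, map_pow]
      exact Finset.prod_dvd_prod_of_dvd _ _ fun t ht => pow_dvd_pow_of_dvd (hinv₁ t ht) _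
  rw [Set.mem_inter_iff, hdual, SetLike.mem_coe, SetLike.mem_coe, mk_mem_span_mk (hdvd e he),
    mk_mem_span_mk (hdvd _ fun t ht => max_le (he t ht) (Nat.sub_le _ _))]
  constructor
  · rintro ⟨h₁, h₂⟩
    refine Finset.prod_dvd_of_coprime (fun t ht t' ht' h => (hcop ht ht' h).pow) fun t ht => ?_
    rcases max_choice (e t) (n - e (σ t)) with h | h <;> rw [h]
    · exact (Finset.dvd_prod_of_mem (fun t => M t ^ e t) ht).trans h₁
    · exact (Finset.dvd_prod_of_mem (fun t => M t ^ (n - e (σ t))) ht).trans h₂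
  · intro h
    exact ⟨(Finset.prod_dvd_prod_of_dvd _ _ fun t _ => pow_dvd_pow _ (le_max_left _ _)).trans h,
      (Finset.prod_dvd_prod_of_dvd _ _ fun t _ => pow_dvd_pow _ (le_max_right _ _)).trans h⟩

end Hull

section Exponents

lemma two_pow_dvd_two_pow_mul_iff {k l : ℕ} {u : ℤ} (hu : Odd u) :
    (2 : ℤ) ^ k ∣ 2 ^ l * u ↔ k ≤ l := by
  have hcop : IsCoprime ((2 : ℤ) ^ k) u := (Int.isCoprime_two_left.2 hu).pow_left
  refine Iff.trans ⟨hcop.dvd_of_dvd_mul_right, fun h => h.mul_right u⟩ ?_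
  exact pow_dvd_pow_iff (by norm_num) (by norm_num [Int.isUnit_iff])

lemma eq_of_two_pow_mul_eq {k l : ℕ} {u v : ℤ} (hu : Odd u) (hv : Odd v)
    (h : (2 : ℤ) ^ k * u = 2 ^ l * v) : k = l ∧ u = v := by
  obtain rfl : k = l := le_antisymm
    ((two_pow_dvd_two_pow_mul_iff hv).1 ⟨u, h.symm⟩) ((two_pow_dvd_two_pow_mul_iff hu).1 ⟨v, h⟩)
  exact ⟨rfl, mul_left_cancel₀ (by positivity) h⟩

lemma not_two_pow_dvd_three_pow_add {k v w : ℕ} (hk : 3 ≤ k) :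
    ¬ (2 : ℤ) ^ k ∣ 3 ^ v + 3 ^ w := by
  intro h
  have h8 : (8 : ℤ) ∣ 3 ^ v + 3 ^ w := (pow_dvd_pow 2 hk).trans h
  have hmod (v : ℕ) : (3 : ℤ) ^ v % 8 = 1 ∨ (3 : ℤ) ^ v % 8 = 3 := by
    induction v with
    | zero => simp
    | succ n ih => rw [pow_succ]; omega
  have := hmod v
  have := hmod w
  omega

lemma eq_of_two_pow_dvd_three_pow_sub {k v w : ℕ} (hv : v < 2 ^ (k - 2)) (hw : w < 2 ^ (k - 2))
    (h : (2 : ℤ) ^ k ∣ 3 ^ v - 3 ^ w) : v = w := by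
  wlog hvw : v ≤ w generalizing v w
  · exact (this hw hv (dvd_sub_comm.1 h) (by omega)).symm
  obtain hk | hk := le_or_gt k 2
  · rw [Nat.sub_eq_zero_of_le hk] at hv hw
    omega
  obtain ⟨n, rfl⟩ : ∃ n, k = n + 3 := ⟨k - 3, by omega⟩
  obtain ⟨d, rfl⟩ := Nat.exists_eq_add_of_le hvw
  have hd : (2 : ℤ) ^ (n + 3) ∣ 3 ^ d - 1 := by
    have h3 : IsCoprime ((2 : ℤ) ^ (n + 3)) (3 ^ v) :=
      (Int.isCoprime_two_left.2 (by decide : Odd (3 : ℤ))).pow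
    refine h3.dvd_of_dvd_mul_left ?_
    rw [dvd_sub_comm] at h
    convert h using 1
    ring
  obtain ⟨c, rfl⟩ : Even d := by
    by_contra hodd
    obtain ⟨c, rfl⟩ := Nat.not_even_iff_odd.1 hodd
    have h8 : (8 : ℤ) ∣ 3 ^ (2 * c + 1) - 1 := (pow_dvd_pow 2 (show 3 ≤ n + 3 by omega)).trans hd
    have hmod : (9 : ℤ) ^ c % 8 = 1 := by
      have h := (show (9 : ℤ) ≡ 1 [ZMOD 8] by decide).pow c
      rwa [one_pow] at h
    rw [pow_succ, pow_mul] at h8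
    norm_num at h8
    omega
  have hord := ZMod.orderOf_one_add_mul_prime_pow Nat.prime_two 3 (by norm_num) (by norm_num) 1
    (by norm_num) n
  have hc : (1 + (2 : ℕ) ^ 3 * (1 : ℤ) : ZMod (2 ^ (n + 3))) ^ c = 1 := by
    have h0 := (ZMod.intCast_zmod_eq_zero_iff_dvd (3 ^ (c + c) - 1) (2 ^ (n + 3))).2
      (by exact_mod_cast hd)
    push_cast at h0 ⊢
    rw [sub_eq_zero, ← mul_two, mul_comm, pow_mul] at h0
    refine Eq.trans ?_ h0
    norm_num
  have hdvd := orderOf_dvd_of_pow_eq_one hc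
  rw [hord] at hdvd
  have hpow : 2 ^ (n + 3 - 2) = 2 * 2 ^ n := by rw [show n + 3 - 2 = n + 1 by omega, pow_succ']
  have := Nat.eq_zero_of_dvd_of_lt hdvd (by omega)
  omega

lemma Dfin_eq (a i : ℕ) : Dfin a i =
    ((Finset.range (2 ^ (min i a - 2))).image fun v => (3 : ℤ) ^ v) ∪
      ((Finset.range (2 ^ (min i a - 2))).image fun v => -(3 : ℤ) ^ v) := by
  unfold Dfin
  split_ifs with h
  · rw [min_eq_left h]
  · rw [min_eq_right (by omega)]

lemma mem_Dfin {a i : ℕ} {u : ℤ} :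
    u ∈ Dfin a i ↔ ∃ v < 2 ^ (min i a - 2), u = 3 ^ v ∨ u = -3 ^ v := by
  simp only [Dfin_eq, Finset.mem_union, Finset.mem_image, Finset.mem_range, ← exists_or,
    ← and_or_left, eq_comm]

lemma odd_of_mem_Dfin {a i : ℕ} {u : ℤ} (hu : u ∈ Dfin a i) : Odd u := by
  have h3 : Odd (3 : ℤ) := by decide
  obtain ⟨v, -, rfl | rfl⟩ := mem_Dfin.1 hu
  · exact h3.pow
  · exact h3.pow.neg

lemma neg_mem_Dfin {a i : ℕ} {u : ℤ} (hu : u ∈ Dfin a i) : -u ∈ Dfin a i := by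
  obtain ⟨v, hv, rfl | rfl⟩ := mem_Dfin.1 hu
  · exact mem_Dfin.2 ⟨v, hv, .inr rfl⟩
  · exact mem_Dfin.2 ⟨v, hv, .inl (neg_neg _)⟩

lemma eq_of_mem_Dfin {a i : ℕ} (ha : 2 ≤ a) (hi : 2 ≤ i) {u u' : ℤ} (hu : u ∈ Dfin a i)
    (hu' : u' ∈ Dfin a i) (h : (2 : ℤ) ^ min i a ∣ u - u') : u = u' := by
  have hk : 2 ≤ min i a := le_min hi ha
  obtain ⟨v, hv, hu⟩ := mem_Dfin.1 hu
  obtain ⟨w, hw, hu'⟩ := mem_Dfin.1 hu'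
  have hmixed : ¬ (2 : ℤ) ^ min i a ∣ 3 ^ v + 3 ^ w := by
    obtain h3 | h2 := le_or_gt 3 (min i a)
    · exact not_two_pow_dvd_three_pow_add h3
    · obtain h2 : min i a = 2 := by omega
      rw [h2] at hv hw ⊢
      obtain rfl : v = 0 := by omega
      obtain rfl : w = 0 := by omega
      norm_num
  rcases hu with rfl | rfl <;> rcases hu' with rfl | rfl
  · rw [eq_of_two_pow_dvd_three_pow_sub hv hw h]
  · exact (hmixed (by simpa using h)).elim
  · exact (hmixed (by rwa [← dvd_neg, neg_add'])).elim
  · rw [eq_of_two_pow_dvd_three_pow_sub hw hv (by rwa [neg_sub_neg] at h)]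

lemma card_Dfin {a i : ℕ} (ha : 2 ≤ a) (hi : 2 ≤ i) : (Dfin a i).card = 2 ^ (min i a - 1) := by
  have h3 : Function.Injective fun v : ℕ => (3 : ℤ) ^ v :=
    pow_right_injective₀ (by norm_num) (by norm_num)
  have h3' : Function.Injective fun v : ℕ => -(3 : ℤ) ^ v := neg_injective.comp h3
  rw [Dfin_eq, Finset.card_union_of_disjoint, Finset.card_image_of_injective _ h3,
    Finset.card_image_of_injective _ h3', Finset.card_range, ← two_mul,
    ← pow_succ']
  · congr 1
    have : 2 ≤ min i a := le_min hi ha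
    omega
  · rw [Finset.disjoint_left]
    simp only [Finset.mem_image, not_exists, not_and]
    rintro _ ⟨v, -, rfl⟩ w - h
    have : (0 : ℤ) < 3 ^ v := by positivity
    have : (0 : ℤ) < 3 ^ w := by positivity
    omega

/-- The set `T_n` of exponents indexing the irreducible factors of `x^(2^r) - 1`. -/
def expSet (a r : ℕ) : Finset ℤ :=
  ({0, 2 ^ (r - 1)} : Finset ℤ) ∪
    (Finset.Icc 2 r).biUnion (fun i => (Dfin a i).image fun u => 2 ^ (r - i) * u)

lemma mem_expSet {a r : ℕ} {t : ℤ} : t ∈ expSet a r ↔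
    t = 0 ∨ t = 2 ^ (r - 1) ∨ ∃ i, (2 ≤ i ∧ i ≤ r) ∧ ∃ u ∈ Dfin a i, 2 ^ (r - i) * u = t := by
  simp [expSet]

lemma two_pow_mul_ne {r i : ℕ} (hi : 2 ≤ i) (hir : i ≤ r) {u : ℤ} (hu : Odd u) :
    2 ^ (r - i) * u ≠ 0 ∧ 2 ^ (r - i) * u ≠ 2 ^ (r - 1) := by
  constructor
  · rintro h
    rcases mul_eq_zero.1 h with h | rfl
    · exact pow_ne_zero _ two_ne_zero h
    · exact absurd hu (by decide)
  · intro h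
    have := (eq_of_two_pow_mul_eq hu odd_one (h.trans (mul_one _).symm)).1
    omega

@[to_additive]
lemma prod_expSet {α : Type*} [CommMonoid α] (a r : ℕ) (φ : ℤ → α) :
    ∏ t ∈ expSet a r, φ t = φ 0 * φ (2 ^ (r - 1)) *
      ∏ i ∈ Finset.Icc 2 r, ∏ u ∈ Dfin a i, φ (2 ^ (r - i) * u) := by
  have h0 : (0 : ℤ) ∉ ({2 ^ (r - 1)} : Finset ℤ) := by
    simpa using (pow_ne_zero (r - 1) (two_ne_zero' ℤ)).symm
  rw [expSet, Finset.prod_union, Finset.prod_insert h0, Finset.prod_singleton,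
    Finset.prod_biUnion]
  · congr 1
    refine Finset.prod_congr rfl fun i _ => Finset.prod_image fun u _ v _ h => ?_
    exact mul_left_cancel₀ (pow_ne_zero _ two_ne_zero) h
  · intro i hi i' hi' hne
    rw [Function.onFun, Finset.disjoint_left]
    simp only [Finset.mem_image, not_exists, not_and]
    rintro _ ⟨u, hu, rfl⟩ v hv h
    have := (eq_of_two_pow_mul_eq (odd_of_mem_Dfin hv) (odd_of_mem_Dfin hu) h).1
    simp only [Finset.coe_Icc, Set.mem_Icc] at hi hi'
    omega
  · rw [Finset.disjoint_right]
    simp only [Finset.mem_biUnion, Finset.mem_image, Finset.mem_Icc, Finset.mem_insert,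
      Finset.mem_singleton, not_or]
    rintro _ ⟨i, ⟨hi, hir⟩, u, hu, rfl⟩
    exact two_pow_mul_ne hi hir (odd_of_mem_Dfin hu)

end Exponents

section RootsOfUnity

lemma mem_range_algebraMap_of_pow_card_eq {F : Type*} [Field F] [Fintype F] {E : Type*} [Field E]
    [Algebra F E] {z : E} (hz : z ^ Fintype.card F = z) : z ∈ (algebraMap F E).range := by
  have hcard := Fintype.one_lt_card (α := F)
  have hsplit : (∏ c : F, (X - C c)) = X ^ Fintype.card F - X := by
    have hmonic : (X ^ Fintype.card F - X : F[X]).Monic :=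
      monic_X_pow_sub (by rw [degree_X]; exact_mod_cast hcard)
    have h := prod_multiset_X_sub_C_of_monic_of_roots_card_eq hmonic (by
      rw [FiniteField.roots_X_pow_card_sub_X, FiniteField.X_pow_card_sub_X_natDegree_eq F hcard]
      rfl)
    rwa [FiniteField.roots_X_pow_card_sub_X] at h
  have h0 : ∏ c : F, (z - algebraMap F E c) = 0 := by
    have := congrArg (aeval z) hsplit
    simpa [map_prod, hz] using this
  obtain ⟨c, -, hc⟩ := Finset.prod_eq_zero_iff.1 h0
  exact ⟨c, (sub_eq_zero.1 hc).symm⟩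

variable {p m a b r : ℕ} {F : Type*} [Field F] {E : Type*} [Field E] [Algebra F E]
  {β : E}

lemma zpow_pow_two_pow_eq_one (hβ : IsPrimitiveRoot β (2 ^ r)) (t : ℤ) :
    (β ^ t) ^ 2 ^ r = 1 := by
  rw [← zpow_natCast, ← zpow_mul, mul_comm, zpow_mul, zpow_natCast, hβ.pow_eq_one, one_zpow]

lemma isIntegral_zpow (hβ : IsPrimitiveRoot β (2 ^ r)) (t : ℤ) : IsIntegral F (β ^ t) :=
  ⟨X ^ 2 ^ r - 1, by
    rw [← C_1]; exact monic_X_pow_sub_C _ (by positivity), by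
    rw [eval₂_sub, eval₂_X_pow, zpow_pow_two_pow_eq_one hβ, eval₂_one, sub_self]⟩

lemma zpow_pow_eq_one_iff (hβ : IsPrimitiveRoot β (2 ^ r)) (t : ℤ) (k : ℕ) :
    (β ^ t) ^ 2 ^ k = 1 ↔ (2 : ℤ) ^ r ∣ 2 ^ k * t := by
  rw [← zpow_natCast, ← zpow_mul, hβ.zpow_eq_one_iff_dvd]
  push_cast
  rw [mul_comm]

lemma aeval_eq_zero_of_minpoly_eq {x y : E} (h : minpoly F x = minpoly F y) {P : F[X]}
    (hx : aeval x P = 0) : aeval y P = 0 :=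
  (minpoly.dvd_iff).1 (h ▸ minpoly.dvd F x hx)

lemma two_pow_dvd_of_minpoly_eq (hβ : IsPrimitiveRoot β (2 ^ r)) {t t' : ℤ}
    (h : minpoly F (β ^ t) = minpoly F (β ^ t')) {k : ℕ} (ht : (2 : ℤ) ^ r ∣ 2 ^ k * t) :
    (2 : ℤ) ^ r ∣ 2 ^ k * t' := by
  rw [← zpow_pow_eq_one_iff hβ] at ht ⊢
  have := aeval_eq_zero_of_minpoly_eq h (P := X ^ 2 ^ k - 1) (by simp [ht])
  simpa [sub_eq_zero] using this

lemma minpoly_zpow_neg_dvd_comp (hβ : IsPrimitiveRoot β (2 ^ r)) {N : ℕ} (hN : 0 < N)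
    (hdvd : 2 ^ r ∣ N) (t : ℤ) :
    minpoly F (β ^ (-t)) ∣ (minpoly F (β ^ t)).comp (X ^ (N - 1)) := by
  have hβ0 : β ≠ 0 := hβ.ne_zero (by positivity)
  have hpow : (β ^ (-t)) ^ (N - 1) = β ^ t := by
    obtain ⟨c, rfl⟩ := hdvd
    have h1 : (β ^ (-t)) ^ (2 ^ r * c) = 1 := by
      rw [pow_mul, zpow_pow_two_pow_eq_one hβ, one_pow]
    rw [pow_sub₀ _ (zpow_ne_zero _ hβ0) hN, h1, one_mul, pow_one, ← zpow_neg, neg_neg]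
  apply minpoly.dvd
  rw [aeval_comp, map_pow, aeval_X, hpow, minpoly.aeval]

lemma natDegree_minpoly_zpow_zero : (minpoly F (β ^ (0 : ℤ))).natDegree = 1 :=
  minpoly.natDegree_eq_one_iff.2 ⟨1, by simp⟩

variable [Fintype F]

lemma two_pow_dvd_sub_of_minpoly_eq (hq : Fintype.card F = 2 ^ a * b + 1)
    (hβ : IsPrimitiveRoot β (2 ^ r)) {t t' : ℤ}
    (h : minpoly F (β ^ t) = minpoly F (β ^ t')) {n : ℕ} (ht : (2 : ℤ) ^ r ∣ 2 ^ (n + a) * t) :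
    (2 : ℤ) ^ r ∣ 2 ^ n * (t - t') := by
  have hβ0 : β ≠ 0 := hβ.ne_zero (by positivity)
  obtain ⟨c, hc⟩ : (β ^ t) ^ 2 ^ n ∈ (algebraMap F E).range := by
    apply mem_range_algebraMap_of_pow_card_eq
    have h1 : ((β ^ t) ^ 2 ^ n) ^ 2 ^ a = 1 := by
      rw [← pow_mul, ← pow_add, (zpow_pow_eq_one_iff hβ _ _).2 ht]
    rw [hq, pow_succ, pow_mul, h1, one_pow, one_mul]
  have h' := aeval_eq_zero_of_minpoly_eq h (P := X ^ 2 ^ n - C c) (by simp [hc])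
  rw [← zpow_pow_eq_one_iff hβ, zpow_sub₀ hβ0, div_pow, ← hc, div_eq_one_iff_eq
    (pow_ne_zero _ (zpow_ne_zero _ hβ0))]
  rw [map_sub, aeval_C, map_pow, aeval_X, sub_eq_zero] at h'
  exact h'.symm

lemma minpoly_zpow_injOn (ha : 2 ≤ a) (hr : 2 ≤ r) (hq : Fintype.card F = 2 ^ a * b + 1)
    (hβ : IsPrimitiveRoot β (2 ^ r)) :
    Set.InjOn (fun t : ℤ => minpoly F (β ^ t)) (expSet a r) := by
  have hform {t : ℤ} (ht : t ∈ expSet a r) : t = 0 ∨ ∃ i, (1 ≤ i ∧ i ≤ r) ∧ ∃ u : ℤ, Odd u ∧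
      ((i = 1 ∧ u = 1) ∨ (2 ≤ i ∧ u ∈ Dfin a i)) ∧ 2 ^ (r - i) * u = t := by
    rcases mem_expSet.1 ht with rfl | rfl | ⟨i, ⟨hi, hir⟩, u, hu, rfl⟩
    · exact .inl rfl
    · exact .inr ⟨1, ⟨le_rfl, by omega⟩, 1, odd_one, .inl ⟨rfl, rfl⟩, mul_one _⟩
    · exact .inr ⟨i, ⟨by omega, hir⟩, u, odd_of_mem_Dfin hu, .inr ⟨hi, hu⟩, rfl⟩
  have hdvd {i k : ℕ} {u : ℤ} (hu : Odd u) (hir : i ≤ r) :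
      (2 : ℤ) ^ r ∣ 2 ^ k * (2 ^ (r - i) * u) ↔ i ≤ k := by
    rw [← mul_assoc, ← pow_add, two_pow_dvd_two_pow_mul_iff hu]
    omega
  intro t ht t' ht' h
  rcases hform ht with rfl | ⟨i, ⟨hi, hir⟩, u, hu, hcase, rfl⟩ <;>
    rcases hform ht' with rfl | ⟨i', ⟨hi', hir'⟩, u', hu', hcase', rfl⟩
  · rfl
  · have := (hdvd hu' hir').1 (two_pow_dvd_of_minpoly_eq hβ h (k := 0) (by simp))
    omega
  · have := (hdvd hu hir).1 (two_pow_dvd_of_minpoly_eq hβ h.symm (k := 0) (by simp))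
    omega
  · obtain rfl : i = i' := le_antisymm
      ((hdvd hu hir).1 (two_pow_dvd_of_minpoly_eq hβ h.symm ((hdvd hu' hir').2 le_rfl)))
      ((hdvd hu' hir').1 (two_pow_dvd_of_minpoly_eq hβ h ((hdvd hu hir).2 le_rfl)))
    rcases hcase with ⟨rfl, rfl⟩ | ⟨h2, hmem⟩
    · obtain ⟨-, rfl⟩ := hcase'.resolve_right (by omega)
      rfl
    · have hmem' : u' ∈ Dfin a i := (hcase'.resolve_left (by omega)).2
      have hsub := two_pow_dvd_sub_of_minpoly_eq (n := i - a) hq hβ h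
        ((hdvd hu hir).2 (by omega))
      rw [← mul_sub, ← mul_assoc, ← pow_add] at hsub
      have hexp : r = (i - a + (r - i)) + min i a := by omega
      conv at hsub => lhs; rw [hexp, pow_add]
      rw [eq_of_mem_Dfin ha h2 hmem hmem'
        ((mul_dvd_mul_iff_left (pow_ne_zero _ two_ne_zero)).1 hsub)]

lemma pairwise_isCoprime_minpoly (ha : 2 ≤ a) (hr : 2 ≤ r)
    (hq : Fintype.card F = 2 ^ a * b + 1) (hβ : IsPrimitiveRoot β (2 ^ r)) :
    (expSet a r : Set ℤ).Pairwise
      (Function.onFun IsCoprime fun t : ℤ => minpoly F (β ^ t)) := by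
  intro t ht t' ht' hne
  have hint := isIntegral_zpow (F := F) hβ
  refine (EuclideanDomain.dvd_or_coprime _ _ (minpoly.irreducible (hint t))).resolve_left
    fun hdvd => hne (minpoly_zpow_injOn ha hr hq hβ ht ht' ?_)
  exact eq_of_monic_of_associated (minpoly.monic (hint t)) (minpoly.monic (hint t'))
    ((minpoly.irreducible (hint t)).associated_of_dvd (minpoly.irreducible (hint t')) hdvd)

lemma orderOf_two_pow_mul_odd_add_one (ha : 2 ≤ a) (hb : Odd b) (i : ℕ) :
    orderOf ((2 ^ a * b + 1 : ℕ) : ZMod (2 ^ i)) = 2 ^ (i - a) := by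
  rcases le_total i a with h | h
  · have h0 : ((2 ^ a * b : ℕ) : ZMod (2 ^ i)) = 0 :=
      (ZMod.natCast_eq_zero_iff _ _).2 ((pow_dvd_pow 2 h).mul_right b)
    rw [Nat.cast_add, h0, Nat.sub_eq_zero_of_le h]
    simp
  · obtain ⟨n, rfl⟩ := Nat.exists_eq_add_of_le' h
    have := ZMod.orderOf_one_add_mul_prime_pow Nat.prime_two a (by omega) (by omega) (b : ℤ)
      (by exact_mod_cast hb.not_two_dvd_nat) n
    rw [Nat.add_sub_cancel, ← this]
    push_cast
    rw [add_comm (1 : ZMod _)]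

lemma natDegree_minpoly_zpow (hp : p.Prime) (hpodd : Odd p) (ha : 2 ≤ a) (hb : Odd b)
    (hF : Fintype.card F = p ^ m) (hq : p ^ m = 2 ^ a * b + 1) (hβ : IsPrimitiveRoot β (2 ^ r))
    {i : ℕ} (hir : i ≤ r) {u : ℤ} (hu : Odd u) :
    (minpoly F (β ^ ((2 : ℤ) ^ (r - i) * u))).natDegree = 2 ^ (i - a) := by
  have : Fact p.Prime := ⟨hp⟩
  have hprim : IsPrimitiveRoot (β ^ ((2 : ℤ) ^ (r - i) * u)) (2 ^ i) := by
    have h1 : IsPrimitiveRoot (β ^ 2 ^ (r - i)) (2 ^ i) :=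
      hβ.pow (by positivity) (by rw [← pow_add, Nat.sub_add_cancel hir])
    rw [zpow_mul]
    have h2 := h1.zpow_of_gcd_eq_one u (by
      rw [← Int.isCoprime_iff_gcd_eq_one]
      push_cast
      exact (Int.isCoprime_two_left.2 hu).symm.pow_right)
    exact_mod_cast h2
  have hcop : p.Coprime (2 ^ i) := (Nat.coprime_two_right.2 hpodd).pow_right i
  have hdvd : minpoly F (β ^ ((2 : ℤ) ^ (r - i) * u)) ∣ cyclotomic (2 ^ i) F := by
    apply minpoly.dvd
    rw [aeval_def, ← eval_map, map_cyclotomic]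
    exact hprim.isRoot_cyclotomic (by positivity)
  rw [natDegree_of_dvd_cyclotomic_of_irreducible hF hcop hdvd
    (minpoly.irreducible (isIntegral_zpow hβ _)), ← orderOf_units, ZMod.coe_unitOfCoprime, hq,
    orderOf_two_pow_mul_odd_add_one ha hb]

lemma natDegree_minpoly_zpow_half (hp : p.Prime) (hpodd : Odd p) (ha : 2 ≤ a) (hr : 2 ≤ r)
    (hb : Odd b) (hF : Fintype.card F = p ^ m) (hq : p ^ m = 2 ^ a * b + 1)
    (hβ : IsPrimitiveRoot β (2 ^ r)) :
    (minpoly F (β ^ ((2 : ℤ) ^ (r - 1)))).natDegree = 1 := by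
  have h := natDegree_minpoly_zpow hp hpodd ha hb hF hq hβ (i := 1) (by omega) odd_one
  rwa [mul_one, Nat.sub_eq_zero_of_le (show 1 ≤ a by omega), pow_zero] at h

lemma prod_minpoly_eq (hp : p.Prime) (hpodd : Odd p) (ha : 2 ≤ a) (hr : 2 ≤ r) (hb : Odd b)
    (hF : Fintype.card F = p ^ m) (hq : p ^ m = 2 ^ a * b + 1) (hβ : IsPrimitiveRoot β (2 ^ r)) :
    ∏ t ∈ expSet a r, minpoly F (β ^ t) = X ^ 2 ^ r - 1 := by
  have hmonic (t : ℤ) : (minpoly F (β ^ t)).Monic := minpoly.monic (isIntegral_zpow hβ t)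
  have hmonic' : (X ^ 2 ^ r - 1 : F[X]).Monic := by
    rw [← C_1]; exact monic_X_pow_sub_C _ (by positivity)
  refine (eq_of_monic_of_dvd_of_natDegree_le (monic_prod_of_monic _ _ fun t _ => hmonic t)
    hmonic' ?_ ?_).symm
  · refine Finset.prod_dvd_of_coprime (pairwise_isCoprime_minpoly ha hr (hF.trans hq) hβ)
      fun t _ => minpoly.dvd _ _ ?_
    simp [zpow_pow_two_pow_eq_one hβ]
  · rw [← C_1, natDegree_X_pow_sub_C, natDegree_prod_of_monic _ _ fun t _ => hmonic t,
      sum_expSet a r fun t => (minpoly F (β ^ t)).natDegree, natDegree_minpoly_zpow_zero,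
      natDegree_minpoly_zpow_half hp hpodd ha hr hb hF hq hβ]
    have hsum : ∑ i ∈ Finset.Icc 2 r, ∑ u ∈ Dfin a i,
        (minpoly F (β ^ ((2 : ℤ) ^ (r - i) * u))).natDegree = ∑ i ∈ Finset.Icc 2 r, 2 ^ (i - 1) := by
      refine Finset.sum_congr rfl fun i hi => ?_
      obtain ⟨hi, hir⟩ := Finset.mem_Icc.1 hi
      rw [Finset.sum_congr rfl fun u hu =>
        natDegree_minpoly_zpow hp hpodd ha hb hF hq hβ hir (odd_of_mem_Dfin hu),
        Finset.sum_const, card_Dfin ha hi, smul_eq_mul, ← pow_add]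
      congr 1
      omega
    have hgeom : ∀ r, 2 ≤ r → 2 + ∑ i ∈ Finset.Icc 2 r, 2 ^ (i - 1) = 2 ^ r := by
      intro r hr
      induction r, hr using Nat.le_induction with
      | base => simp
      | succ n hn ih =>
        rw [Finset.sum_Icc_succ_top (by omega), ← add_assoc, ih, Nat.add_sub_cancel, pow_succ,
          mul_two]
    rw [hsum, ← hgeom r hr]

end RootsOfUnity

section SignFlip

/-- The involution `t ↦ -t` of the exponent set, keeping the representatives `0` and `2^(r-1)`. -/
def negExp (r : ℕ) (t : ℤ) : ℤ :=
  if t = 0 ∨ t = 2 ^ (r - 1) then t else -t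

variable {a r : ℕ}

lemma negExp_zero : negExp r 0 = 0 := by simp [negExp]

lemma negExp_half : negExp r (2 ^ (r - 1)) = 2 ^ (r - 1) := by simp [negExp]

lemma negExp_two_pow_mul {i : ℕ} (hi : 2 ≤ i) (hir : i ≤ r) {u : ℤ} (hu : Odd u) :
    negExp r (2 ^ (r - i) * u) = 2 ^ (r - i) * (-u) := by
  obtain ⟨h0, h1⟩ := two_pow_mul_ne hi hir hu
  rw [negExp, if_neg (by simp only [h0, h1, or_self, not_false_eq_true]), mul_neg]

lemma negExp_mem {t : ℤ} (ht : t ∈ expSet a r) : negExp r t ∈ expSet a r := by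
  rcases mem_expSet.1 ht with rfl | rfl | ⟨i, ⟨hi, hir⟩, u, hu, rfl⟩
  · rwa [negExp_zero]
  · rwa [negExp_half]
  · rw [negExp_two_pow_mul hi hir (odd_of_mem_Dfin hu)]
    exact mem_expSet.2 (.inr (.inr ⟨i, ⟨hi, hir⟩, -u, neg_mem_Dfin hu, rfl⟩))

lemma negExp_negExp {t : ℤ} (ht : t ∈ expSet a r) : negExp r (negExp r t) = t := by
  rcases mem_expSet.1 ht with rfl | rfl | ⟨i, ⟨hi, hir⟩, u, hu, rfl⟩
  · rw [negExp_zero, negExp_zero]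
  · rw [negExp_half, negExp_half]
  · rw [negExp_two_pow_mul hi hir (odd_of_mem_Dfin hu),
      negExp_two_pow_mul hi hir (odd_of_mem_Dfin hu).neg, neg_neg]

lemma zpow_negExp {E : Type*} [Field E] {β : E} (hr : 2 ≤ r) (hβ : IsPrimitiveRoot β (2 ^ r))
    (t : ℤ) : β ^ negExp r t = β ^ (-t) := by
  unfold negExp
  split_ifs with h
  · rcases h with rfl | rfl
    · rw [neg_zero]
    · have hβ0 : β ≠ 0 := hβ.ne_zero (by positivity)
      rw [zpow_neg]
      apply eq_inv_of_mul_eq_one_left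
      rw [← zpow_add₀ hβ0, ← mul_two, ← pow_succ, Nat.sub_add_cancel (by omega)]
      exact_mod_cast hβ.pow_eq_one
  · rfl

end SignFlip

/-- for `q = p^m = 2^a·b+1`, the hull `Hull(C) = C ∩ C^⊥` of the cyclic
code `C = ⟨m_0^{j_0}·m_{2^{r−1}}^{j_{2^{r−1}}}·∏_{i=2}^r ∏_{u∈D_i} m_{2^{r−i}u}^{j_{2^{r−i}u}}⟩`
of length `2^r·p^s` is the cyclic code generated by the product with exponents
`max(j_t, p^s − j_{t^*})`, and its `F_q`-dimension is `2^r·p^s − (max(j_0,p^s−j_0) +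
max(j_{2^{r−1}},p^s−j_{2^{r−1}}) + e)` with `e` as in the statement (according to
whether `r ≤ a` or `r > a`). -/
theorem stmt18 (p m a b r s : ℕ) (hp : p.Prime) (hpodd : Odd p) (hm : 0 < m) (hs : 0 < s)
    (hb : Odd b) (ha : 2 ≤ a) (hr : 2 ≤ r) (hq : p ^ m = 2 ^ a * b + 1)
    (F : Type*) [Field F] [Fintype F] (hF : Fintype.card F = p ^ m)
    (E : Type*) [Field E] [Algebra F E] (β : E) (hβ : IsPrimitiveRoot β (2 ^ r))
    (N : ℕ) (hN : N = 2 ^ r * p ^ s) (hf : (X ^ N - 1 : Polynomial F) ≠ 0)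
    (j : ℤ → ℕ) (hj : ∀ t ∈ ({0, 2 ^ (r - 1)} : Finset ℤ) ∪
      (Finset.Icc 2 r).biUnion (fun i => (Dfin a i).image fun u => 2 ^ (r - i) * u), j t ≤ p ^ s)
    (C : Ideal (AdjoinRoot (X ^ N - 1 : Polynomial F)))
    (hC : C = Ideal.span {AdjoinRoot.mk (X ^ N - 1 : Polynomial F)
      (minpoly F (β ^ (0 : ℤ)) ^ j 0 *
        minpoly F (β ^ ((2 : ℤ) ^ (r - 1))) ^ j (2 ^ (r - 1)) *
        ∏ i ∈ Finset.Icc 2 r, ∏ u ∈ Dfin a i,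
          minpoly F (β ^ ((2 : ℤ) ^ (r - i) * u)) ^ j (2 ^ (r - i) * u))}) :
    let Hull : Ideal (AdjoinRoot (X ^ N - 1 : Polynomial F)) :=
      Ideal.span {AdjoinRoot.mk (X ^ N - 1 : Polynomial F)
        (minpoly F (β ^ (0 : ℤ)) ^ max (j 0) (p ^ s - j 0) *
          minpoly F (β ^ ((2 : ℤ) ^ (r - 1))) ^
            max (j (2 ^ (r - 1))) (p ^ s - j (2 ^ (r - 1))) *
          ∏ i ∈ Finset.Icc 2 r, ∏ u ∈ Dfin a i,
            minpoly F (β ^ ((2 : ℤ) ^ (r - i) * u)) ^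
              max (j (2 ^ (r - i) * u)) (p ^ s - j (2 ^ (r - i) * (-u))))}
    (↑C ∩ dualCode hf C = (Hull : Set (AdjoinRoot (X ^ N - 1 : Polynomial F)))) ∧
    (r ≤ a → Module.finrank F (Submodule.restrictScalars F Hull) =
      2 ^ r * p ^ s - (max (j 0) (p ^ s - j 0) +
        max (j (2 ^ (r - 1))) (p ^ s - j (2 ^ (r - 1))) +
        ∑ i ∈ Finset.Icc 2 r, ∑ u ∈ Dfin a i,
          max (j (2 ^ (r - i) * u)) (p ^ s - j (2 ^ (r - i) * (-u))))) ∧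
    (a < r → Module.finrank F (Submodule.restrictScalars F Hull) =
      2 ^ r * p ^ s - (max (j 0) (p ^ s - j 0) +
        max (j (2 ^ (r - 1))) (p ^ s - j (2 ^ (r - 1))) +
        ((∑ i ∈ Finset.Icc 2 a, ∑ u ∈ Dfin a i,
            max (j (2 ^ (r - i) * u)) (p ^ s - j (2 ^ (r - i) * (-u)))) +
          ∑ i ∈ Finset.Icc (a + 1) r, ∑ u ∈ Dfin a i,
            2 ^ (i - a) *
              max (j (2 ^ (r - i) * u)) (p ^ s - j (2 ^ (r - i) * (-u)))))) := by
  intro Hull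
  have : Fact p.Prime := ⟨hp⟩
  have : CharP F p := charP_of_card_eq_prime_pow hF
  have hN0 : 0 < N := by rw [hN]; exact Nat.mul_pos (by positivity) (pow_pos hp.pos _)
  have hmonic (t : ℤ) : (minpoly F (β ^ t)).Monic := minpoly.monic (isIntegral_zpow hβ t)
  have hprod : ∏ t ∈ expSet a r, minpoly F (β ^ t) ^ p ^ s = X ^ N - 1 := by
    rw [Finset.prod_pow, prod_minpoly_eq hp hpodd ha hr hb hF hq hβ, sub_pow_char_pow, one_pow,
      ← pow_mul, hN]
  have hHull : Hull = Ideal.span {AdjoinRoot.mk (X ^ N - 1 : F[X])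
      (∏ t ∈ expSet a r, minpoly F (β ^ t) ^ max (j t) (p ^ s - j (negExp r t)))} := by
    rw [prod_expSet, negExp_zero, negExp_half]
    simp only [Hull]
    congr! 6 with i hi u hu
    obtain ⟨hi, hir⟩ := Finset.mem_Icc.1 hi
    rw [negExp_two_pow_mul hi hir (odd_of_mem_Dfin hu)]
  have hfinrank : Module.finrank F (Submodule.restrictScalars F Hull) =
      2 ^ r * p ^ s - (max (j 0) (p ^ s - j 0) +
        max (j (2 ^ (r - 1))) (p ^ s - j (2 ^ (r - 1))) +
        ∑ i ∈ Finset.Icc 2 r, ∑ u ∈ Dfin a i, 2 ^ (i - a) *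
          max (j (2 ^ (r - i) * u)) (p ^ s - j (2 ^ (r - i) * (-u)))) := by
    rw [hHull, finrank_span_mk hf, ← C_1, natDegree_X_pow_sub_C, hN,
      natDegree_prod_of_monic _ _ fun t _ => (hmonic t).pow _]
    · congr 1
      simp only [(hmonic _).natDegree_pow]
      rw [sum_expSet, negExp_zero, negExp_half, natDegree_minpoly_zpow_zero,
        natDegree_minpoly_zpow_half hp hpodd ha hr hb hF hq hβ, mul_one, mul_one]
      congr 1
      refine Finset.sum_congr rfl fun i hi => Finset.sum_congr rfl fun u hu => ?_
      obtain ⟨hi, hir⟩ := Finset.mem_Icc.1 hi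
      have hodd := odd_of_mem_Dfin hu
      rw [negExp_two_pow_mul hi hir hodd, natDegree_minpoly_zpow hp hpodd ha hb hF hq hβ hir hodd,
        mul_comm]
    · rw [← hprod]
      exact Finset.prod_dvd_prod_of_dvd _ _ fun t ht =>
        pow_dvd_pow _ (max_le (hj t ht) (Nat.sub_le _ _))
  refine ⟨?_, fun hra => ?_, fun har => ?_⟩
  · rw [hHull, hC, ← prod_expSet a r fun t => minpoly F (β ^ t) ^ j t]
    refine inter_dualCode_eq _ (fun t : ℤ => minpoly F (β ^ t)) (negExp r) j (p ^ s) hN0 hf hprod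
      (pairwise_isCoprime_minpoly ha hr (hF.trans hq) hβ) (fun t => negExp_mem)
      (fun t => negExp_negExp) (fun t _ => ?_) hj
    rw [zpow_negExp hr hβ]
    exact minpoly_zpow_neg_dvd_comp hβ hN0 (hN ▸ dvd_mul_right _ _) t
  · rw [hfinrank]
    congr 2
    refine Finset.sum_congr rfl fun i hi => Finset.sum_congr rfl fun u _ => ?_
    rw [Nat.sub_eq_zero_of_le ((Finset.mem_Icc.1 hi).2.trans hra), pow_zero, one_mul]
  · rw [hfinrank]
    congr 2
    have hIcc (n : ℕ) : Finset.Icc n r = Finset.Ico n (r + 1) := rfl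
    rw [hIcc, ← Finset.sum_Ico_consecutive _ (show 2 ≤ a + 1 by omega) (by omega)]
    congr 1
    refine Finset.sum_congr rfl fun i hi => Finset.sum_congr rfl fun u _ => ?_
    rw [Nat.sub_eq_zero_of_le (Nat.lt_succ_iff.1 (Finset.mem_Ico.1 hi).2), pow_zero, one_mul]
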